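/- Let W : ℝ → ℝ satisfy W(x) * exp(W(x)) = x and W(x) > 0 for all x > 0. Then for all x > 0, W(x) = (1/π) * ∫ from 0 to π of log(1 + x * (sin v / v) * exp(v * cot v)) dv. -/

import Mathlib

open Real Filter Topology

theorem Complex.eq_ofReal_of_mul_exp_eq {w : ℝ} (hw : 0 < w) {z : ℂ} (hz : |z.im| < π)
    (h : z * Complex.exp z = (w * Real.exp w : ℝ)) : z = w := by
  have hre := congrArg Complex.re h
  have him := congrArg Complex.im h
  rw [Complex.mul_re, Complex.exp_re, Complex.exp_im, Complex.ofReal_re] at hre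
  rw [Complex.mul_im, Complex.exp_re, Complex.exp_im, Complex.ofReal_im] at him
  obtain ⟨a, v⟩ := z
  simp only at hre him hz
  have hx : 0 < w * Real.exp w := by positivity
  have hea := Real.exp_pos a
  have hv : v = 0 := by
    by_contra hv
    have h1 : w * Real.exp w * Real.sin v = -v * Real.exp a := by
      linear_combination (-Real.sin v) * hre + Real.cos v * him
        - v * Real.exp a * Real.sin_sq_add_cos_sq v
    obtain ⟨hl, hr⟩ := abs_lt.mp hz
    rcases lt_or_gt_of_ne hv with hv | hv
    · have := Real.sin_neg_of_neg_of_neg_pi_lt hv hl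
      nlinarith
    · have := Real.sin_pos_of_pos_of_lt_pi hv hr
      nlinarith
  subst hv
  simp only [Real.cos_zero, Real.sin_zero] at hre
  have ha : a * Real.exp a = w * Real.exp w := by linarith
  have ha0 : 0 < a := by
    by_contra! h0
    nlinarith
  have haw : a = w := by
    rcases lt_trichotomy a w with hlt | heq | hlt
    · have := Real.exp_lt_exp.mpr hlt
      nlinarith
    · exact heq
    · have := Real.exp_lt_exp.mpr hlt
      nlinarith
  subst haw
  rfl

theorem Complex.exists_primitive_mul_exp_sub {w x : ℝ} (hw : 0 < w) (hx : w * Real.exp w = x) :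
    ∃ T K : ℂ → ℂ, (∀ z : ℂ, |z.im| < π → HasDerivAt T (K z) z) ∧
      ∀ z : ℂ, |z.im| < π → z ≠ w →
        K z = x * (1 + z) / (z * Complex.exp z - x) - w / (z - w) := by
  set S : Set ℂ := {z | |z.im| < π} with hS
  have hSo : IsOpen S := isOpen_lt (by fun_prop) (by fun_prop)
  have hSc : Convex ℝ S := by
    have : S = Complex.imLm ⁻¹' Set.Ioo (-π) π := by
      ext z; simp [hS, abs_lt]
    rw [this]
    exact (convex_Ioo _ _).linear_preimage _
  have hwS : S ∈ nhds (w : ℂ) := hSo.mem_nhds (by simp [hS, Real.pi_pos])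
  set φ : ℂ → ℂ := fun z => z * Complex.exp z with hφ
  have hφd : Differentiable ℂ φ := by fun_prop
  have hφw : φ w = x := by rw [← hx]; push_cast; rfl
  have hφ' : deriv φ w = (1 + w) * Complex.exp w := by
    have : HasDerivAt φ _ (w : ℂ) := (hasDerivAt_id (w : ℂ)).mul (Complex.hasDerivAt_exp w)
    rw [this.deriv]; simp; ring
  set A := dslope φ (w : ℂ) with hA
  have hAd : DifferentiableOn ℂ A S :=
    (Complex.differentiableOn_dslope hwS).mpr hφd.differentiableOn
  have hAmul (z : ℂ) : (z - w) * A z = φ z - x := by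
    rw [← hφw, ← sub_smul_dslope φ (w : ℂ) z, smul_eq_mul]
  have h1w : (1 + w : ℂ) ≠ 0 := by exact_mod_cast (by positivity : (1 + w : ℝ) ≠ 0)
  have hA0 : ∀ z ∈ S, A z ≠ 0 := by
    intro z hz h0
    have hzw : z = w := Complex.eq_ofReal_of_mul_exp_eq hw hz (by
      have := hAmul z
      rw [h0, mul_zero] at this
      rw [hx]
      exact (sub_eq_zero.mp this.symm))
    rw [hzw, hA, dslope_same, hφ'] at h0
    exact mul_ne_zero h1w (Complex.exp_ne_zero _) h0
  set N : ℂ → ℂ := fun z => x * (1 + z) / A z - w with hN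
  have hNd : DifferentiableOn ℂ N S :=
    (DifferentiableOn.div (by fun_prop) hAd hA0).sub_const _
  have hNw : N w = 0 := by
    simp only [hN, hA, dslope_same, hφ', ← hx]
    have := Complex.exp_ne_zero w
    push_cast
    field_simp
    ring
  have hKd := (Complex.differentiableOn_dslope hwS).mpr hNd
  obtain ⟨T, hT⟩ := hSc.exists_forall_hasDerivWithinAt hKd
  refine ⟨T, dslope N w, fun z hz => (hT z hz).hasDerivAt (hSo.mem_nhds hz), fun z hz hzw => ?_⟩
  have hzw' : z - w ≠ 0 := sub_ne_zero.mpr hzw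
  rw [dslope_of_ne _ hzw, slope_def_field, hNw, sub_zero]
  have := hAmul z
  simp only [hφ] at this
  rw [← this]
  simp only [hN]
  have := hA0 z hz
  field_simp

theorem Real.mul_sinc (v : ℝ) : v * Real.sinc v = Real.sin v := by
  by_cases h : v = 0
  · simp [h]
  · rw [Real.sinc_of_ne_zero h]; field_simp

theorem Real.sinc_pos {v : ℝ} (hv : |v| < π) : 0 < Real.sinc v := by
  by_cases h : v = 0
  · simp [h]
  have h1 := Real.mul_sinc v
  obtain ⟨hl, hr⟩ := abs_lt.mp hv
  rcases lt_or_gt_of_ne h with h | h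
  · have := Real.sin_neg_of_neg_of_neg_pi_lt h hl
    nlinarith
  · have := Real.sin_pos_of_pos_of_lt_pi h hr
    nlinarith

/-- The kernel `v ↦ (sin v / v) exp (v cot v)`, with its removable singularity filled in. -/
noncomputable def lambertKernel (v : ℝ) : ℝ :=
  Real.sinc v * Real.exp (Real.cos v / Real.sinc v)

/-- The curve `v ↦ -v cot v + i v`, which `z ↦ z exp z` maps to the cut `(-∞, -1/e]`. -/
noncomputable def lambertCurve (v : ℝ) : ℂ :=
  ((-(Real.cos v / Real.sinc v) : ℝ) : ℂ) + v * Complex.I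

theorem lambertCurve_re (v : ℝ) : (lambertCurve v).re = -(Real.cos v / Real.sinc v) := by
  simp [lambertCurve, -Complex.ofReal_neg, -Complex.ofReal_div]

theorem lambertCurve_im (v : ℝ) : (lambertCurve v).im = v := by
  simp [lambertCurve, -Complex.ofReal_neg, -Complex.ofReal_div]

theorem lambertCurve_neg (v : ℝ) :
    lambertCurve (-v) = (starRingEnd ℂ) (lambertCurve v) := by
  apply Complex.ext <;> simp [lambertCurve_re, lambertCurve_im]

theorem lambertKernel_neg (v : ℝ) : lambertKernel (-v) = lambertKernel v := by
  simp [lambertKernel]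

theorem lambertKernel_nonneg {v : ℝ} (hv : |v| ≤ π) : 0 ≤ lambertKernel v := by
  refine mul_nonneg ?_ (Real.exp_pos _).le
  rcases hv.lt_or_eq with h | h
  · exact (Real.sinc_pos h).le
  · rcases eq_or_eq_neg_of_abs_eq h with rfl | rfl <;> simp [Real.sinc]

theorem lambertKernel_pos {v : ℝ} (hv : |v| < π) : 0 < lambertKernel v :=
  mul_pos (Real.sinc_pos hv) (Real.exp_pos _)

theorem lambertCurve_mul_exp {v : ℝ} (hv : |v| < π) :
    lambertCurve v * Complex.exp (lambertCurve v) = -(lambertKernel v : ℂ)⁻¹ := by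
  have hs : (Real.sinc v : ℂ) ≠ 0 := by exact_mod_cast (Real.sinc_pos hv).ne'
  have hm : (v : ℂ) * Real.sinc v = Complex.sin v := by
    rw [← Complex.ofReal_sin, ← Real.mul_sinc v]; push_cast; rfl
  have hE : (Real.exp (Real.cos v / Real.sinc v) : ℂ) ≠ 0 := by
    exact_mod_cast (Real.exp_pos _).ne'
  have h1 : lambertCurve v * Real.sinc v = -(Complex.cos v - Complex.sin v * Complex.I) := by
    rw [lambertCurve, ← hm]
    push_cast
    field_simp
    ring
  have h2 : Complex.exp (lambertCurve v) * Real.exp (Real.cos v / Real.sinc v)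
      = Complex.cos v + Complex.sin v * Complex.I := by
    rw [← Complex.exp_mul_I, Complex.ofReal_exp, ← Complex.exp_add, lambertCurve]
    congr 1
    push_cast
    ring
  have h3 := Complex.sin_sq_add_cos_sq (v : ℂ)
  rw [lambertKernel]
  push_cast [-Complex.ofReal_exp]
  have h4 : lambertCurve v * Complex.exp (lambertCurve v) *
      (Real.sinc v * Real.exp (Real.cos v / Real.sinc v)) = -1 := by
    calc _ = (lambertCurve v * Real.sinc v) *
        (Complex.exp (lambertCurve v) * Real.exp (Real.cos v / Real.sinc v)) := by ring
      _ = _ := by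
        rw [h1, h2]
        linear_combination (-1 : ℂ) * h3 + Complex.sin v ^ 2 * Complex.I_sq
  rw [← one_div, ← neg_div, eq_div_iff (mul_ne_zero hs hE), h4]

theorem continuousAt_cos_div_sinc {v : ℝ} (hv : |v| < π) :
    ContinuousAt (fun v => Real.cos v / Real.sinc v) v :=
  Real.continuous_cos.continuousAt.div Real.continuous_sinc.continuousAt (Real.sinc_pos hv).ne'

theorem continuousAt_lambertKernel {v : ℝ} (hv : |v| < π) : ContinuousAt lambertKernel v :=
  Real.continuous_sinc.continuousAt.mul (continuousAt_cos_div_sinc hv).rexp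

theorem continuousAt_lambertCurve {v : ℝ} (hv : |v| < π) : ContinuousAt lambertCurve v := by
  have := continuousAt_cos_div_sinc hv
  unfold lambertCurve
  fun_prop

theorem exists_hasDerivAt_lambertCurve {v : ℝ} (hv : |v| < π) (h0 : v ≠ 0) :
    ∃ d : ℝ, HasDerivAt lambertCurve (d + Complex.I) v := by
  have hs : DifferentiableAt ℝ Real.sinc v := by
    rw [Real.sinc_eq_dslope, differentiableAt_dslope_of_ne h0]
    exact Real.differentiableAt_sin
  have ha : DifferentiableAt ℝ (fun v => -(Real.cos v / Real.sinc v)) v :=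
    (Real.differentiableAt_cos.div hs (Real.sinc_pos hv).ne').neg
  refine ⟨_, ha.hasDerivAt.ofReal_comp.add ?_⟩
  simpa using (hasDerivAt_id v).ofReal_comp.mul_const Complex.I

theorem tendsto_lambertCurve_re :
    Tendsto (fun v => (lambertCurve v).re) (𝓝[<] π) atTop := by
  have h1 : Tendsto (fun v => -Real.cos v) (𝓝[<] π) (𝓝 1) := by
    have : Tendsto (fun v => -Real.cos v) (𝓝 π) (𝓝 (-Real.cos π)) :=
      Real.continuous_cos.neg.tendsto _
    simpa using this.mono_left nhdsWithin_le_nhds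
  have h2 : Tendsto Real.sinc (𝓝[<] π) (𝓝[>] 0) := by
    rw [tendsto_nhdsWithin_iff]
    constructor
    · have := Real.continuous_sinc.tendsto π
      rw [Real.sinc_of_ne_zero Real.pi_ne_zero, Real.sin_pi, zero_div] at this
      exact this.mono_left nhdsWithin_le_nhds
    · filter_upwards [Ioo_mem_nhdsLT Real.pi_pos] with v hv
      exact Real.sinc_pos (by rw [abs_of_pos hv.1]; exact hv.2)
  refine (h1.pos_mul_atTop one_pos h2.inv_tendsto_nhdsGT_zero).congr fun v => ?_
  rw [lambertCurve_re]
  simp [div_eq_mul_inv]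

theorem tendsto_lambertKernel_pi : Tendsto lambertKernel (𝓝[<] π) (𝓝 0) := by
  have h2 : Tendsto Real.sinc (𝓝[<] π) (𝓝 0) := by
    have := Real.continuous_sinc.tendsto π
    rw [Real.sinc_of_ne_zero Real.pi_ne_zero, Real.sin_pi, zero_div] at this
    exact this.mono_left nhdsWithin_le_nhds
  have := h2.mul (Real.tendsto_exp_neg_atTop_nhds_zero.comp tendsto_lambertCurve_re)
  simpa [Function.comp_def, lambertCurve_re, ← lambertKernel.eq_def] using this

theorem continuousOn_lambertKernel : ContinuousOn lambertKernel (Set.Icc 0 π) := by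
  intro v hv
  rcases hv.2.lt_or_eq with h | rfl
  · exact (continuousAt_lambertKernel (by rwa [abs_of_nonneg hv.1])).continuousWithinAt
  · have : ContinuousWithinAt lambertKernel (Set.Iio π) π := by
      have h := tendsto_lambertKernel_pi
      rwa [show (0 : ℝ) = lambertKernel π by simp [lambertKernel, Real.sinc]] at h
    exact (continuousWithinAt_Iio_iff_Iic.mp this).mono Set.Icc_subset_Iic_self

theorem norm_sub_le_of_hasDerivAt_eq_mul_exp_sub {w x : ℝ} (hw : 0 < w) (hx : 0 < x)
    {T K : ℂ → ℂ} (hT : ∀ z : ℂ, |z.im| < π → HasDerivAt T (K z) z)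
    (hK : ∀ z : ℂ, |z.im| < π → z ≠ w →
      K z = x * (1 + z) / (z * Complex.exp z - x) - w / (z - w))
    {a : ℝ} (ha : w + x + 1 < a) {z₁ z₂ : ℂ} (h1 : |z₁.im| < π) (h2 : |z₂.im| < π)
    (hz1 : z₁.re = a) (hz2 : z₂.re = a) :
    ‖T z₂ - T z₁‖ ≤ (2 * x / (1 + a - x) + w / (a - w)) * (2 * π) := by
  set S : Set ℂ := {z | |z.im| < π ∧ z.re = a} with hS
  have hSc : Convex ℝ S := by
    have : S = Complex.imLm ⁻¹' Set.Ioo (-π) π ∩ Complex.reLm ⁻¹' {a} := by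
      ext z; simp [hS, abs_lt]
    rw [this]
    exact ((convex_Ioo _ _).linear_preimage _).inter ((convex_singleton a).linear_preimage _)
  have hbound : ∀ z ∈ S, ‖K z‖ ≤ 2 * x / (1 + a - x) + w / (a - w) := by
    rintro z ⟨hz, hza⟩
    have hzw : z ≠ w := by
      rintro rfl
      simp at hza
      linarith
    have hza' : a ≤ ‖z‖ := hza ▸ Complex.re_le_norm z
    have hexp : 1 + a ≤ Real.exp a := by linarith [Real.add_one_le_exp a]
    have hd1 : ‖z‖ * (1 + a - x) ≤ ‖z * Complex.exp z - x‖ := by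
      have := norm_sub_norm_le (z * Complex.exp z) x
      rw [norm_mul, Complex.norm_exp, hza, Complex.norm_real, Real.norm_of_nonneg hx.le] at this
      nlinarith
    have hd2 : a - w ≤ ‖z - w‖ := by
      have := Complex.re_le_norm (z - w)
      simpa [hza] using this
    have hn : ‖(x : ℂ) * (1 + z)‖ ≤ ‖z‖ * (2 * x) := by
      rw [norm_mul, Complex.norm_real, Real.norm_of_nonneg hx.le]
      have := norm_add_le (1 : ℂ) z
      rw [norm_one] at this
      nlinarith
    have hz0 : 0 < ‖z‖ := by linarith
    have hax : 0 < 1 + a - x := by linarith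
    rw [hK z hz hzw]
    refine (norm_sub_le _ _).trans (add_le_add ?_ ?_)
    · rw [norm_div, ← mul_div_mul_left (2 * x) _ hz0.ne']
      gcongr
    · rw [norm_div, Complex.norm_real, Real.norm_of_nonneg hw.le]
      have : 0 < a - w := by linarith
      gcongr
  have hdist : ‖z₂ - z₁‖ ≤ 2 * π := by
    have h : z₂ - z₁ = ((z₂.im - z₁.im : ℝ) : ℂ) * Complex.I := by
      apply Complex.ext <;> simp [hz1, hz2]
    rw [h, norm_mul, Complex.norm_I, mul_one, Complex.norm_real, Real.norm_eq_abs]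
    exact (abs_sub _ _).trans (by linarith)
  refine (hSc.norm_image_sub_le_of_norm_hasDerivWithin_le
    (fun z hz => (hT z hz.1).hasDerivWithinAt) hbound ⟨h1, hz1⟩ ⟨h2, hz2⟩).trans ?_
  have : 0 ≤ 2 * x / (1 + a - x) + w / (a - w) :=
    add_nonneg (div_nonneg (by linarith) (by linarith)) (div_nonneg hw.le (by linarith))
  gcongr

theorem tendsto_arg_sub_lambertCurve (w : ℝ) :
    Tendsto (fun v => Complex.arg (w - lambertCurve v)) (𝓝[<] π) (𝓝 (-π)) := by
  have hre := tendsto_lambertCurve_re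
  have hinv : Tendsto (fun v => (lambertCurve v).re⁻¹) (𝓝[<] π) (𝓝 0) :=
    tendsto_inv_atTop_zero.comp hre
  have hpos : ∀ᶠ v in 𝓝[<] π, 0 < (lambertCurve v).re := hre.eventually_gt_atTop 0
  have hv : Tendsto (fun v : ℝ => v) (𝓝[<] π) (𝓝 π) := nhdsWithin_le_nhds
  have hlim : Tendsto (fun v => (((lambertCurve v).re⁻¹ : ℝ) : ℂ) * (w - lambertCurve v))
      (𝓝[<] π) (𝓝[{z : ℂ | z.im < 0}] (-1)) := by
    rw [tendsto_nhdsWithin_iff]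
    constructor
    · have h : Tendsto (fun v => (((lambertCurve v).re⁻¹ * w - 1 : ℝ) : ℂ) -
          (((lambertCurve v).re⁻¹ * v : ℝ) : ℂ) * Complex.I) (𝓝[<] π)
          (𝓝 (((0 * w - 1 : ℝ) : ℂ) - ((0 * π : ℝ) : ℂ) * Complex.I)) :=
        ((Complex.continuous_ofReal.tendsto _).comp ((hinv.mul_const w).sub_const 1)).sub
          (((Complex.continuous_ofReal.tendsto _).comp (hinv.mul hv)).mul_const _)
      rw [show ((0 * w - 1 : ℝ) : ℂ) - ((0 * π : ℝ) : ℂ) * Complex.I = -1 by simp] at h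
      refine h.congr' ?_
      filter_upwards [hpos] with v hv
      apply Complex.ext <;> simp [lambertCurve_im, -Complex.ofReal_inv]
      field_simp
    · filter_upwards [hpos, Ioo_mem_nhdsLT Real.pi_pos] with v hv hv'
      have : 0 < (lambertCurve v).re⁻¹ * v := mul_pos (inv_pos.mpr hv) hv'.1
      simpa [lambertCurve_im, -Complex.ofReal_inv] using this
  refine ((Complex.tendsto_arg_nhdsWithin_im_neg_of_re_neg_of_im_zero
    (z := -1) (by simp) (by simp)).comp hlim).congr' ?_
  filter_upwards [hpos] with v hv
  exact Complex.arg_real_mul _ (inv_pos.mpr hv)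

theorem sub_lambertCurve_mem_slitPlane {w v : ℝ} (hw : 0 < w) :
    (w : ℂ) - lambertCurve v ∈ Complex.slitPlane := by
  by_cases h : v = 0
  · left
    subst h
    simp [lambertCurve_re]
    linarith
  · right
    simpa [lambertCurve_im] using h

/-- A function on the curve whose derivative has imaginary part `log (1 + x * lambertKernel v)`. -/
noncomputable def lambertPrimitive (w x : ℝ) (T : ℂ → ℂ) (v : ℝ) : ℂ :=
  lambertCurve v * (Real.log (1 + x * lambertKernel v) : ℝ) - T (lambertCurve v)
    - w * Complex.log (w - lambertCurve v)

theorem continuousAt_lambertPrimitive {w x : ℝ} (hw : 0 < w) (hx : 0 < x) {T : ℂ → ℂ} {v : ℝ}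
    (hv : |v| < π) (hT : ContinuousAt T (lambertCurve v)) :
    ContinuousAt (lambertPrimitive w x T) v := by
  have hc := continuousAt_lambertCurve hv
  have hg := lambertKernel_pos hv
  have hk := continuousAt_lambertKernel hv
  refine ((hc.mul ?_).sub (ContinuousAt.comp hT hc)).sub
    (continuousAt_const.mul ((continuousAt_const.sub hc).clog (sub_lambertCurve_mem_slitPlane hw)))
  refine Complex.continuous_ofReal.continuousAt.comp ?_
  exact (continuousAt_const.add (continuousAt_const.mul hk)).log
    (add_pos one_pos (mul_pos hx hg)).ne'

theorem exists_hasDerivAt_lambertPrimitive {w x : ℝ} (hw : 0 < w) (hx : 0 < x) {T K : ℂ → ℂ}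
    (hT : ∀ z : ℂ, |z.im| < π → HasDerivAt T (K z) z)
    (hK : ∀ z : ℂ, |z.im| < π → z ≠ w →
      K z = x * (1 + z) / (z * Complex.exp z - x) - w / (z - w))
    {v : ℝ} (hv : |v| < π) (h0 : v ≠ 0) :
    ∃ D : ℂ, HasDerivAt (lambertPrimitive w x T) D v ∧
      D.im = Real.log (1 + x * lambertKernel v) := by
  obtain ⟨d, hd⟩ := exists_hasDerivAt_lambertCurve hv h0
  have key {u : ℝ} (hu : |u| < π) : ((1 + x * lambertKernel u : ℝ) : ℂ) =
      1 - x / (lambertCurve u * Complex.exp (lambertCurve u)) := by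
    rw [lambertCurve_mul_exp hu]
    push_cast
    rw [div_neg, div_inv_eq_mul]
    ring
  have hpos {u : ℝ} (hu : |u| < π) : 0 < 1 + x * lambertKernel u := by
    have := lambertKernel_pos hu
    positivity
  have hlogeq {u : ℝ} (hu : |u| < π) : ((Real.log (1 + x * lambertKernel u) : ℝ) : ℂ) =
      Complex.log (1 - x / (lambertCurve u * Complex.exp (lambertCurve u))) := by
    rw [Complex.ofReal_log (hpos hu).le, key hu]
  have hslit : 1 - x / (lambertCurve v * Complex.exp (lambertCurve v)) ∈ Complex.slitPlane := by
    rw [← key hv]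
    exact Complex.ofReal_mem_slitPlane.mpr (hpos hv)
  have hφ0 : lambertCurve v * Complex.exp (lambertCurve v) ≠ 0 := by
    rw [lambertCurve_mul_exp hv]
    exact neg_ne_zero.mpr (inv_ne_zero (by exact_mod_cast (lambertKernel_pos hv).ne'))
  have hz0 : lambertCurve v ≠ 0 := left_ne_zero_of_mul hφ0
  have him : |(lambertCurve v).im| < π := by rwa [lambertCurve_im]
  have hzw : lambertCurve v - w ≠ 0 := by
    intro h
    have := congrArg Complex.im h
    simp [lambertCurve_im] at this
    exact h0 this
  have hφx : lambertCurve v * Complex.exp (lambertCurve v) - x ≠ 0 := by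
    intro h
    apply Complex.slitPlane_ne_zero hslit
    rw [← sub_eq_zero.mp h, div_self hφ0, sub_self]
  have hlog := (((hd.mul hd.cexp).inv hφ0).const_mul (x : ℂ)).const_sub 1 |>.clog_real
    (by simpa [div_eq_mul_inv] using hslit)
  have hlog' := hlog.congr_of_eventuallyEq
      (f₁ := fun u => ((Real.log (1 + x * lambertKernel u) : ℝ) : ℂ)) <| by
    have : ∀ᶠ u : ℝ in 𝓝 v, |u| < π := continuous_abs.continuousAt.eventually_lt_const hv
    filter_upwards [this] with u hu
    rw [hlogeq hu]
    simp [div_eq_mul_inv]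
  have hTd := (hT _ him).comp_of_eq v hd rfl
  have hwlog := ((hd.const_sub (w : ℂ)).clog_real (sub_lambertCurve_mem_slitPlane hw)).const_mul
    (w : ℂ)
  refine ⟨(d + Complex.I) * (Real.log (1 + x * lambertKernel v) : ℝ), ?_, ?_⟩
  · refine (((hd.mul hlog').sub hTd).sub hwlog).congr_deriv ?_
    rw [hK _ him (sub_ne_zero.mp hzw)]
    have hzw' : (w : ℂ) - lambertCurve v ≠ 0 := by rwa [← neg_sub, neg_ne_zero]
    have e1 : (w : ℂ) / (lambertCurve v - w) = -(w / (w - lambertCurve v)) := by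
      rw [← neg_sub, div_neg]
    have e2 : 1 - (x : ℂ) * (lambertCurve v * Complex.exp (lambertCurve v))⁻¹ =
      (lambertCurve v * Complex.exp (lambertCurve v) - x) /
        (lambertCurve v * Complex.exp (lambertCurve v)) := by field_simp
    have hE := Complex.exp_ne_zero (lambertCurve v)
    simp only [Pi.mul_apply, Pi.inv_apply]
    rw [e1, e2]
    field_simp
    ring
  · simp

theorem integral_log_one_add_mul_lambertKernel {w x : ℝ} (hw : 0 < w)
    (hx : w * Real.exp w = x) :
    ∫ v in (0 : ℝ)..π, Real.log (1 + x * lambertKernel v) = π * w := by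
  have hx0 : 0 < x := hx ▸ by positivity
  obtain ⟨T, K, hT, hK⟩ := Complex.exists_primitive_mul_exp_sub hw hx
  have hcont : ContinuousOn (fun v => Real.log (1 + x * lambertKernel v)) (Set.Icc 0 π) := by
    refine (continuousOn_const.add (continuousOn_const.mul continuousOn_lambertKernel)).log ?_
    intro v hv
    have := lambertKernel_nonneg (v := v) (by rw [abs_of_nonneg hv.1]; exact hv.2)
    exact (add_pos_of_pos_of_nonneg one_pos (mul_nonneg hx0.le this)).ne'
  set Ψ : ℝ → ℝ := fun v => (lambertPrimitive w x T v - lambertPrimitive w x T (-v)).im / 2 with hΨ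
  have hderiv : ∀ v ∈ Set.Ioo (0 : ℝ) π,
      HasDerivAt Ψ (Real.log (1 + x * lambertKernel v)) v := by
    intro v hv
    have hvπ : |v| < π := by rw [abs_of_pos hv.1]; exact hv.2
    obtain ⟨D₁, hD₁, hi₁⟩ := exists_hasDerivAt_lambertPrimitive hw hx0 hT hK hvπ hv.1.ne'
    obtain ⟨D₂, hD₂, hi₂⟩ := exists_hasDerivAt_lambertPrimitive hw hx0 hT hK
      (v := -v) (by rwa [abs_neg]) (neg_ne_zero.mpr hv.1.ne')
    have h := hD₁.sub (hD₂.scomp v (hasDerivAt_neg v))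
    have h' := (Complex.imCLM.hasFDerivAt.comp_hasDerivAt v h).div_const 2
    refine h'.congr_deriv ?_
    rw [lambertKernel_neg] at hi₂
    simp [hi₁, hi₂]
  have h0 : Tendsto Ψ (𝓝[>] 0) (𝓝 0) := by
    have hc : ContinuousAt (lambertPrimitive w x T) 0 :=
      continuousAt_lambertPrimitive hw hx0 (by simp [Real.pi_pos])
        (hT _ (by simp [lambertCurve_im, Real.pi_pos])).continuousAt
    have hcn : ContinuousAt (fun v => lambertPrimitive w x T (-v)) 0 :=
      ContinuousAt.comp_of_eq hc continuousAt_neg neg_zero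
    have hΨc : ContinuousAt Ψ 0 :=
      (Complex.continuous_im.continuousAt.comp (hc.sub hcn)).div_const 2
    have : Ψ 0 = 0 := by simp [hΨ]
    exact (this ▸ hΨc.tendsto).mono_left nhdsWithin_le_nhds
  have hπ : Tendsto Ψ (𝓝[<] π) (𝓝 (π * w)) := by
    have hTlim : Tendsto (fun v => T (lambertCurve v) - T (lambertCurve (-v))) (𝓝[<] π) (𝓝 0) := by
      have hb : Tendsto (fun a : ℝ => (2 * x / (1 + a - x) + w / (a - w)) * (2 * π)) atTop
          (𝓝 ((0 + 0) * (2 * π))) := by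
        refine ((Tendsto.const_div_atTop ?_ _).add (Tendsto.const_div_atTop ?_ _)).mul_const _
        · exact tendsto_atTop_add_const_right _ _ (tendsto_atTop_add_const_left _ _ tendsto_id)
        · exact tendsto_atTop_add_const_right _ _ tendsto_id
      rw [add_zero, zero_mul] at hb
      refine squeeze_zero_norm' ?_ (hb.comp tendsto_lambertCurve_re)
      filter_upwards [tendsto_lambertCurve_re.eventually_gt_atTop (w + x + 1),
        Ioo_mem_nhdsLT Real.pi_pos] with v hv hv'
      have hvπ : |v| < π := by rw [abs_of_pos hv'.1]; exact hv'.2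
      refine norm_sub_le_of_hasDerivAt_eq_mul_exp_sub hw hx0 hT hK hv ?_ ?_ ?_ rfl
      · rwa [lambertCurve_im, abs_neg]
      · rwa [lambertCurve_im]
      · rw [lambertCurve_neg, Complex.conj_re]
    have hlog : Tendsto (fun v => Real.log (1 + x * lambertKernel v)) (𝓝[<] π) (𝓝 0) := by
      have : Tendsto (fun v => 1 + x * lambertKernel v) (𝓝[<] π) (𝓝 (1 + x * 0)) :=
        (tendsto_lambertKernel_pi.const_mul x).const_add 1
      simpa using this.log (by simp)
    have hv : Tendsto (fun v : ℝ => v) (𝓝[<] π) (𝓝 π) := nhdsWithin_le_nhds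
    have hsum := ((hv.mul hlog).sub
      (((Complex.continuous_im.tendsto _).comp hTlim).div_const 2)).sub
        ((tendsto_arg_sub_lambertCurve w).const_mul w)
    rw [show π * 0 - (0 : ℂ).im / 2 - w * -π = π * w by simp; ring] at hsum
    refine hsum.congr' ?_
    filter_upwards [Ioo_mem_nhdsLT Real.pi_pos] with v hv'
    have hconj : (w : ℂ) - lambertCurve (-v) = (starRingEnd ℂ) (w - lambertCurve v) := by
      rw [map_sub, Complex.conj_ofReal, lambertCurve_neg]
    have hlc : Complex.log (w - lambertCurve (-v)) =
        (starRingEnd ℂ) (Complex.log (w - lambertCurve v)) := by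
      rw [hconj, Complex.log_conj _
        (Complex.slitPlane_arg_ne_pi (sub_lambertCurve_mem_slitPlane hw))]
    simp only [hΨ, lambertPrimitive, hlc, lambertKernel_neg]
    simp [lambertCurve_im, Complex.log_im]
    ring
  rw [intervalIntegral.integral_eq_sub_of_hasDerivAt_of_tendsto Real.pi_pos hderiv
    (hcont.intervalIntegrable_of_Icc Real.pi_pos.le) h0 hπ, sub_zero]

/-- Thorin–Bernstein representation of Lambert W on `(0, ∞)`. -/
theorem lambertW_thorin_bernstein (W : ℝ → ℝ)
    (hW : ∀ x > 0, W x * Real.exp (W x) = x) (hWpos : ∀ x > 0, W x > 0) :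
    ∀ x > (0:ℝ),
      W x = (1 / π) * ∫ v in (0:ℝ)..π,
        Real.log (1 + x * (Real.sin v / v) * Real.exp (v * Real.cot v)) := by
  intro x hx
  have hcongr : ∫ v in (0:ℝ)..π,
      Real.log (1 + x * (Real.sin v / v) * Real.exp (v * Real.cot v)) =
      ∫ v in (0:ℝ)..π, Real.log (1 + x * lambertKernel v) := by
    refine intervalIntegral.integral_congr_uIoo fun v hv => ?_
    rw [Set.uIoo_of_le Real.pi_pos.le] at hv
    have hv0 := hv.1.ne'
    rw [lambertKernel, Real.sinc_of_ne_zero hv0, Real.cot_eq_cos_div_sin, mul_assoc,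
      mul_div_left_comm, div_div_eq_mul_div, mul_div_assoc]
  rw [hcongr, integral_log_one_add_mul_lambertKernel (hWpos x hx) (hW x hx)]
  field_simp
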